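/- arXiv:1009.5538 — 2 statements merged into one kernel-verified Lean document; each statement's English description precedes it below -/
import Mathlib

section
/- Let X = x_1, …, x_m be a finite sequence over a set with decidable equality, let Y and Z be complementary subsequences partitioning X, and let 1 ≤ j ≤ |Y| with i = m_Y(j). Let W_X(i) be the set of indices of first occurrences of distinct values within the working-set window of position i in X. Then the number of indices of W_X(i) lying in the range of m_Y (i.e., coming from the subsequence Y) is at most w_Y(j). -/
/-- The working-set window of position `i` in the sequence `x`: indices `j < i`
such that no occurrence of `x i` lies in `[j, i)`, i.e. indices strictly between
the previous occurrence `ω_X(i)` of `x i` (if any) and `i`. -/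
def wsWindow {α : Type*} [DecidableEq α] {m : ℕ} (x : Fin m → α) (i : Fin m) :
    Finset (Fin m) :=
  Finset.univ.filter (fun j => j < i ∧ ∀ k : Fin m, j ≤ k → k < i → x k ≠ x i)

/-- The working-set number `w_X(i)`: number of distinct values in the window. -/
def wsNum {α : Type*} [DecidableEq α] {m : ℕ} (x : Fin m → α) (i : Fin m) : ℕ :=
  ((wsWindow x i).image x).card

/-- The working-set bound `Σ_i lg (w_X(i) + 2)`. -/
noncomputable def wsBound {α : Type*} [DecidableEq α] {m : ℕ} (x : Fin m → α) : ℝ :=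
  ∑ i : Fin m, Real.logb 2 ((wsNum x i : ℝ) + 2)

/-- `W_X(i)`: indices in the working-set window of `i` that are first
occurrences of their value within the window. -/
def wsSet {α : Type*} [DecidableEq α] {m : ℕ} (x : Fin m → α) (i : Fin m) :
    Finset (Fin m) :=
  (wsWindow x i).filter (fun j => ∀ j' ∈ wsWindow x i, j' < j → x j' ≠ x j)

/-- Distinct elements of `wsSet x i` carry distinct values. -/
theorem injOn_wsSet {α : Type*} [DecidableEq α] {m : ℕ} (x : Fin m → α) (i : Fin m) :
    Set.InjOn x (wsSet x i) := by
  intro a ha b hb hab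
  simp only [wsSet, Finset.coe_filter, Set.mem_ofPred_eq] at ha hb
  rcases lt_trichotomy a b with h | h | h
  · exact absurd hab (hb.2 a ha.1 h)
  · exact h
  · exact absurd hab.symm (ha.2 b hb.1 h)

/-- The working-set window of a sequence pulls back into that of a subsequence. -/
theorem mem_wsWindow_comp {α : Type*} [DecidableEq α] {m p : ℕ} {x : Fin m → α}
    {f : Fin p → Fin m} (hf : StrictMono f) {j k : Fin p}
    (h : f k ∈ wsWindow x (f j)) : k ∈ wsWindow (x ∘ f) j := by
  simp only [wsWindow, Finset.mem_filter, Finset.mem_univ, true_and] at h ⊢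
  exact ⟨hf.lt_iff_lt.1 h.1, fun l hkl hlj => h.2 (f l) (hf.monotone hkl) (hf hlj)⟩

/-- For `i = m_Y(j)`, the number of indices of `W_X(i)` coming from the
subsequence `Y` is at most `w_Y(j)`. -/
theorem wsSet_from_Y_le_wsNum_Y
    {α : Type*} [DecidableEq α] {m p q : ℕ}
    (x : Fin m → α) (y : Fin p → α) (z : Fin q → α)
    (mY : Fin p → Fin m) (mZ : Fin q → Fin m)
    (hmY : StrictMono mY) (hmZ : StrictMono mZ)
    (hdisj : ∀ j k, mY j ≠ mZ k)
    (hcover : ∀ i : Fin m, (∃ j, mY j = i) ∨ (∃ k, mZ k = i))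
    (hy : ∀ j, y j = x (mY j))
    (hz : ∀ k, z k = x (mZ k))
    (j : Fin p) :
    ((wsSet x (mY j)).filter (fun k => ∃ j', mY j' = k)).card ≤ wsNum y j := by
  obtain rfl : y = x ∘ mY := funext hy
  rw [wsNum, ← Finset.card_image_of_injOn
    ((injOn_wsSet x (mY j)).mono (Finset.coe_subset.2 (Finset.filter_subset _ _)))]
  refine Finset.card_le_card fun v hv => ?_
  simp only [Finset.mem_image, Finset.mem_filter] at hv ⊢
  obtain ⟨_, ⟨hk, k, rfl⟩, rfl⟩ := hv
  exact ⟨k, mem_wsWindow_comp hmY (Finset.mem_filter.1 hk).1, rfl⟩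
end

section
/- The static-optimality (entropy) bound dominates the working-set bound: there exists an absolute constant c > 0 such that for every finite sequence X = x_1, …, x_m over any set with decidable equality, Σ_{i=1}^m lg(w_X(i)+2) ≤ c·Σ_{i=1}^m lg(m/q(x_i)+1), where q(a) is the number of indices i with x_i = a. -/
/-- `q(a)`: the number of indices `i` with `x i = a`. -/
def freq {α : Type*} [DecidableEq α] {m : ℕ} (x : Fin m → α) (a : α) : ℕ :=
  (Finset.univ.filter (fun i => x i = a)).card

lemma disjoint_wsWindow {α : Type*} [DecidableEq α] {m : ℕ} (x : Fin m → α)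
    {i k : Fin m} (hx : x i = x k) (hik : i ≠ k) :
    Disjoint (wsWindow x i) (wsWindow x k) := by
  rw [Finset.disjoint_left]
  intro j hi hk
  simp only [wsWindow, Finset.mem_filter, Finset.mem_univ, true_and] at hi hk
  rcases lt_or_gt_of_ne hik with h | h
  · exact hk.2 i hi.1.le h hx
  · exact hi.2 k hk.1.le h hx.symm

/-- The windows of the occurrences of a fixed value are disjoint, so the working-set
numbers of these occurrences sum to at most the length of the sequence. -/
lemma sum_wsNum_le {α : Type*} [DecidableEq α] {m : ℕ} (x : Fin m → α) (a : α) :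
    ∑ i with x i = a, wsNum x i ≤ m := by
  calc ∑ i with x i = a, wsNum x i
      ≤ ∑ i with x i = a, (wsWindow x i).card :=
        Finset.sum_le_sum fun i _ => Finset.card_image_le
    _ = ((Finset.univ.filter fun i => x i = a).biUnion (wsWindow x)).card := by
        refine (Finset.card_biUnion fun i hi k hk hik => ?_).symm
        exact disjoint_wsWindow x
          ((Finset.mem_filter.mp hi).2.trans (Finset.mem_filter.mp hk).2.symm) hik
    _ ≤ m := (Finset.card_le_univ _).trans_eq (Fintype.card_fin m)

lemma freq_le {α : Type*} [DecidableEq α] {m : ℕ} (x : Fin m → α) (a : α) :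
    freq x a ≤ m := by
  simpa [freq] using Finset.card_le_univ (Finset.univ.filter fun i => x i = a)

/-- Concavity of the logarithm on the occurrences of a fixed value. -/
lemma sum_log_wsNum_le {α : Type*} [DecidableEq α] {m : ℕ} (x : Fin m → α) (a : α)
    (ha : 0 < freq x a) :
    ∑ i with x i = a, Real.log ((wsNum x i : ℝ) + 2) ≤
      freq x a * Real.log ((m : ℝ) / freq x a + 2) := by
  set q : ℝ := (freq x a : ℝ) with hq
  have hq0 : 0 < q := Nat.cast_pos.mpr ha
  set T : ℝ := m / q + 2 with hT
  have hT0 : 0 < T := by positivity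
  have hqT : q * T = m + 2 * q := by rw [hT]; field_simp
  have hcard : ((Finset.univ.filter fun i => x i = a).card : ℝ) = q := rfl
  have hsum : ∑ i with x i = a, (wsNum x i : ℝ) ≤ m := by
    exact_mod_cast sum_wsNum_le x a
  calc ∑ i with x i = a, Real.log ((wsNum x i : ℝ) + 2)
      ≤ ∑ i with x i = a, (Real.log T + (((wsNum x i : ℝ) + 2) / T - 1)) := by
        refine Finset.sum_le_sum fun i _ => ?_
        have h := Real.log_le_sub_one_of_pos
          (show 0 < ((wsNum x i : ℝ) + 2) / T by positivity)
        rw [Real.log_div (by positivity) hT0.ne'] at h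
        linarith
    _ = q * Real.log T + ((∑ i with x i = a, (wsNum x i : ℝ) + q * 2) / T - q) := by
        simp only [Finset.sum_add_distrib, Finset.sum_sub_distrib, ← Finset.sum_div,
          Finset.sum_const, nsmul_eq_mul, hcard, mul_one]
    _ ≤ q * Real.log T := by
        have : (∑ i with x i = a, (wsNum x i : ℝ) + q * 2) / T ≤ q := by
          rw [div_le_iff₀ hT0]
          linarith
        linarith

lemma log_add_two_le {t : ℝ} (ht : 1 ≤ t) :
    Real.log (t + 2) ≤ 2 * Real.log (t + 1) := by
  rw [show 2 * Real.log (t + 1) = Real.log ((t + 1) ^ 2) by simp [Real.log_pow]]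
  exact Real.log_le_log (by linarith) (by nlinarith)

/-- The static-optimality (entropy) bound dominates the working-set bound. -/
theorem workingSet_le_staticOptimality :
    ∃ c : ℝ, 0 < c ∧
      ∀ (α : Type*) [DecidableEq α] (m : ℕ) (x : Fin m → α),
        wsBound x ≤
          c * ∑ i : Fin m,
                Real.logb 2 ((m : ℝ) / (freq x (x i) : ℝ) + 1) := by
  refine ⟨2, two_pos, fun α _ m x => ?_⟩
  simp only [wsBound, Real.logb, ← Finset.sum_div]
  rw [← mul_div_assoc]
  refine div_le_div_of_nonneg_right ?_ (Real.log_nonneg one_le_two)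
  have hmaps : ∀ i ∈ (Finset.univ : Finset (Fin m)), x i ∈ Finset.univ.image x :=
    fun i hi => Finset.mem_image_of_mem x hi
  rw [← Finset.sum_fiberwise_of_maps_to hmaps, ← Finset.sum_fiberwise_of_maps_to hmaps,
    Finset.mul_sum]
  refine Finset.sum_le_sum fun a ha => ?_
  obtain ⟨i, -, hi⟩ := Finset.mem_image.mp ha
  have hpos : 0 < freq x a := Finset.card_pos.mpr ⟨i, by simpa using hi⟩
  have hpos' : (0 : ℝ) < freq x a := by exact_mod_cast hpos
  have hone : (1 : ℝ) ≤ (m : ℝ) / freq x a := by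
    rw [one_le_div hpos']
    exact_mod_cast freq_le x a
  have hconst : ∑ i with x i = a, Real.log ((m : ℝ) / (freq x (x i) : ℝ) + 1) =
      freq x a * Real.log ((m : ℝ) / freq x a + 1) := by
    rw [Finset.sum_congr rfl fun i hi => by rw [(Finset.mem_filter.mp hi).2],
      Finset.sum_const, nsmul_eq_mul, freq]
  rw [hconst]
  calc _ ≤ _ := sum_log_wsNum_le x a hpos
    _ ≤ freq x a * (2 * Real.log ((m : ℝ) / freq x a + 1)) :=
        mul_le_mul_of_nonneg_left (log_add_two_le hone) hpos'.le
    _ = _ := by ring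
end
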